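/- Let (δ,σ) be a modular pair in involution on H. Then k, equipped with the right H-action α·h = δ(h)α and the left H-coaction α ↦ σ⊗α, is a right-left SAYD module over H (denoted ^σk_δ): the coaction is counital and coassociative, the anti-Yetter–Drinfeld condition holds, which amounts to the identity δ(h₂)S(h₃)σh₁ = δ(h)σ in H for all h ∈ H, and stability holds. -/

import Mathlib

open TensorProduct DirectSum

noncomputable section

namespace HopfCyclicStmt

variable (k H : Type) [Field k] [CharZero k] [Ring H] [HopfAlgebra k H]

/-! ### Left `H`-categories -/

/-- A left `H`-category: a small `k`-linear category whose Hom-spaces are left `H`-modules,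
such that `h • id_X = ε(h) • id_X` and `h • (g ∘ f) = (h₁ • g) ∘ (h₂ • f)` (the latter stated
by quantifying over all finite representations of `comul h` as a sum of pure tensors). -/
structure HCategory (k H : Type) [Field k] [Ring H] [HopfAlgebra k H] where
  Obj : Type
  Hom : Obj → Obj → Type
  [homAddCommGroup : ∀ X Y, AddCommGroup (Hom X Y)]
  [homModule : ∀ X Y, Module k (Hom X Y)]
  id : (X : Obj) → Hom X X
  comp : {X Y Z : Obj} → Hom Y Z →ₗ[k] Hom X Y →ₗ[k] Hom X Z
  id_comp : ∀ {X Y : Obj} (f : Hom X Y), comp (id Y) f = f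
  comp_id : ∀ {X Y : Obj} (f : Hom X Y), comp f (id X) = f
  comp_assoc : ∀ {W X Y Z : Obj} (h : Hom Y Z) (g : Hom X Y) (f : Hom W X),
      comp h (comp g f) = comp (comp h g) f
  act : (X Y : Obj) → H →ₗ[k] Hom X Y →ₗ[k] Hom X Y
  act_one : ∀ {X Y : Obj} (f : Hom X Y), act X Y 1 f = f
  act_mul : ∀ {X Y : Obj} (a b : H) (f : Hom X Y),
      act X Y (a * b) f = act X Y a (act X Y b f)
  act_id : ∀ (X : Obj) (h : H), act X X h (id X) = Coalgebra.counit (R := k) h • id X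
  act_comp : ∀ {X Y Z : Obj} (h : H) (g : Hom Y Z) (f : Hom X Y)
      {ι : Type} (s : Finset ι) (a b : ι → H),
      Coalgebra.comul (R := k) h = ∑ i ∈ s, a i ⊗ₜ[k] b i →
      act X Z h (comp g f) = ∑ i ∈ s, comp (act Y Z (a i) g) (act X Y (b i) f)

attribute [instance] HCategory.homAddCommGroup HCategory.homModule

/-! ### Iterated comultiplication and Sweedler representations -/

/-- `H^{⊗(n+1)}` as iterated binary tensor products, bundled as a module. -/
def TPow : ℕ → ModuleCat.{0} k
  | 0 => ModuleCat.of k H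
  | n + 1 => ModuleCat.of k (H ⊗[k] (TPow n))

/-- The pure tensor `c 0 ⊗ c 1 ⊗ ⋯ ⊗ c n` in `H^{⊗(n+1)}`. -/
def chainT : (n : ℕ) → (Fin (n + 1) → H) → TPow k H n
  | 0, c => (c 0 : H)
  | n + 1, c => show H ⊗[k] (TPow k H n) from (c 0) ⊗ₜ[k] (chainT n fun j => c j.succ)

/-- The iterated comultiplication `Δⁿ : H → H^{⊗(n+1)}`. -/
def comulIter : (n : ℕ) → (H →ₗ[k] TPow k H n)
  | 0 => LinearMap.id
  | n + 1 => show H →ₗ[k] (H ⊗[k] (TPow k H n)) from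
      (LinearMap.lTensor H (comulIter n)) ∘ₗ (Coalgebra.comul (R := k))

/-- `∑ᵢ c i 0 ⊗ ⋯ ⊗ c i n` is a finite representation of `Δⁿ h` by pure tensors;
in Sweedler notation, `c i j` plays the role of `h_{j+1}`. -/
def IsComulRep (n : ℕ) (h : H) {ι : Type} (s : Finset ι) (c : ι → Fin (n + 1) → H) : Prop :=
  comulIter k H n h = ∑ i ∈ s, chainT k H n (c i)

/-! ### group-likes and the twisted antipode -/

variable {k H}

/-- `σ` is a group-like element. -/
def IsGroupLike (σ : H) : Prop :=
  Coalgebra.comul (R := k) σ = σ ⊗ₜ[k] σ ∧ Coalgebra.counit (R := k) σ = 1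

/-- The `δ`-twisted antipode `S_δ(h) = δ(h₁) S(h₂)`. -/
def twistedAntipode (δ : H →ₐ[k] k) : H →ₗ[k] H :=
  (TensorProduct.lid k H).toLinearMap
    ∘ₗ TensorProduct.map δ.toLinearMap (HopfAlgebra.antipode (R := k))
    ∘ₗ Coalgebra.comul (R := k)



lemma tw_repr (δ : H →ₐ[k] k) (a : H) {ι : Type*} (r : Coalgebra.Repr k a ι) :
    twistedAntipode δ a
      = ∑ i ∈ r.index, δ (r.left i) • HopfAlgebra.antipode (R := k) (r.right i) := by
  simp [twistedAntipode, ← r.eq, map_sum]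

lemma tw_one (δ : H →ₐ[k] k) : twistedAntipode δ 1 = 1 := by
  simp [twistedAntipode, Algebra.TensorProduct.one_def]

lemma tw_mul (δ : H →ₐ[k] k) (a b : H) :
    twistedAntipode δ (a * b) = twistedAntipode δ b * twistedAntipode δ a := by
  rw [tw_repr δ a (Coalgebra.Repr.arbitrary k a), tw_repr δ b (Coalgebra.Repr.arbitrary k b)]
  have h : twistedAntipode δ (a * b) = (TensorProduct.lid k H)
      (TensorProduct.map δ.toLinearMap (HopfAlgebra.antipode (R := k))
        (Coalgebra.comul (R := k) a * Coalgebra.comul (R := k) b)) := by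
    simp [twistedAntipode]
  rw [h, ← (Coalgebra.Repr.arbitrary k a).eq, ← (Coalgebra.Repr.arbitrary k b).eq]
  simp only [Finset.sum_mul_sum, map_sum, Algebra.TensorProduct.tmul_mul_tmul,
    TensorProduct.map_tmul, TensorProduct.lid_tmul, AlgHom.toLinearMap_apply, map_mul,
    HopfAlgebra.antipode_mul_antidistrib, smul_mul_smul_comm]
  rw [Finset.sum_comm]
  simp only [mul_comm (δ _) (δ _)]

open WithConv in
lemma tw_conv (δ : H →ₐ[k] k) :
    toConv (twistedAntipode δ)
      = toConv (Algebra.linearMap k H ∘ₗ δ.toLinearMap) * toConv (HopfAlgebra.antipode k (A := H)) := by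
  ext a
  rw [(Coalgebra.Repr.arbitrary k a).convMul_apply]
  simp [tw_repr δ a (Coalgebra.Repr.arbitrary k a), Algebra.smul_def]

open WithConv in
lemma tw_mul_id (δ : H →ₐ[k] k) (a : H) {ι : Type*} (r : Coalgebra.Repr k a ι) :
    ∑ i ∈ r.index, twistedAntipode δ (r.left i) * r.right i = algebraMap k H (δ a) := by
  have h : toConv (twistedAntipode δ) * toConv LinearMap.id
      = toConv (Algebra.linearMap k H ∘ₗ δ.toLinearMap) := by
    rw [tw_conv, mul_assoc, LinearMap.antipode_mul_id, mul_one]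
  have h2 := congrArg (fun f => f.ofConv a) h
  simp only at h2
  have h3 := r.convMul_apply (toConv (twistedAntipode δ)) (toConv LinearMap.id)
  simpa using h3.symm.trans h2

lemma tw_key (δ : H →ₐ[k] k) (σ σinv : H) (hσinv₂ : σinv * σ = 1)
    (hMPI : ∀ h : H, twistedAntipode δ (twistedAntipode δ h) = σ * h * σinv)
    (a : H) {ι : Type*} (r : Coalgebra.Repr k a ι) :
    ∑ i ∈ r.index, twistedAntipode δ (r.right i) * σ * r.left i = δ a • σ := by
  have h := congrArg (twistedAntipode δ) (tw_mul_id δ a r)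
  rw [Algebra.algebraMap_eq_smul_one, map_smul, tw_one, map_sum] at h
  simp only [tw_mul, hMPI] at h
  have h2 := congrArg (· * σ) h
  simpa [Finset.sum_mul, mul_assoc, hσinv₂] using h2

/-- The map `x ⊗ y ⊗ z ↦ δ(y) S(z) σ x`. -/
def bigF (δ : H →ₐ[k] k) (σ : H) : H ⊗[k] (H ⊗[k] H) →ₗ[k] H :=
  TensorProduct.lift ((LinearMap.mul k H).flip.compl₂
      (LinearMap.mulRight k σ ∘ₗ (TensorProduct.lid k H).toLinearMap
    ∘ₗ TensorProduct.map δ.toLinearMap (HopfAlgebra.antipode (R := k))))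

lemma bigF_tmul (δ : H →ₐ[k] k) (σ x : H) (w : H ⊗[k] H) :
    bigF δ σ (x ⊗ₜ w) = (TensorProduct.lid k H)
      (TensorProduct.map δ.toLinearMap (HopfAlgebra.antipode (R := k)) w) * σ * x := by
  simp [bigF]

lemma ayd_key (δ : H →ₐ[k] k) (σ σinv : H) (hσinv₂ : σinv * σ = 1)
    (hMPI : ∀ h : H, twistedAntipode δ (twistedAntipode δ h) = σ * h * σinv)
    (h : H) {ι : Type} (s : Finset ι) (c : ι → Fin 3 → H) (hc : IsComulRep k H 2 h s c) :
    ∑ i ∈ s, δ (c i 1) • (HopfAlgebra.antipode (R := k) (c i 2) * σ * c i 0) = δ h • σ := by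
  have hc' : LinearMap.lTensor H (LinearMap.lTensor H LinearMap.id ∘ₗ Coalgebra.comul (R := k))
      (Coalgebra.comul (R := k) h) = ∑ i ∈ s, c i 0 ⊗ₜ[k] (c i 1 ⊗ₜ[k] c i 2) := hc
  have h2 := congrArg (bigF δ σ) hc'
  rw [← tw_key δ σ σinv hσinv₂ hMPI h (Coalgebra.Repr.arbitrary k h)]
  rw [← (Coalgebra.Repr.arbitrary k h).eq] at h2
  simp only [map_sum, LinearMap.lTensor_tmul, bigF_tmul, LinearMap.lTensor_id,
    LinearMap.id_comp, TensorProduct.map_tmul, TensorProduct.lid_tmul,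
    AlgHom.toLinearMap_apply, smul_mul_assoc] at h2
  exact h2.symm

/-- **Statement 14.** Let `(δ,σ)` be a modular pair in involution on `H`.  Then `k`, with right
`H`-action `α · h = δ(h)α` and left `H`-coaction `α ↦ σ ⊗ α`, is a right-left SAYD module over
`H` (denoted `^σk_δ`): the action and coaction axioms hold, the coaction is counital and
coassociative, the anti-Yetter–Drinfeld condition holds — which amounts to the identity
`δ(h₂) S(h₃) σ h₁ = δ(h) σ` in `H` — and stability holds. -/
theorem statement14
    (hbij : Function.Bijective (HopfAlgebra.antipode (R := k) (A := H)))
    (δ : H →ₐ[k] k) (σ : H) (hσ : IsGroupLike (k := k) σ) (hδσ : δ σ = 1)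
    (σinv : H) (hσinv₁ : σ * σinv = 1) (hσinv₂ : σinv * σ = 1)
    (hMPI : ∀ h : H, twistedAntipode δ (twistedAntipode δ h) = σ * h * σinv) :
    -- right `H`-module axioms for `α · h := δ(h) α`
    (∀ α : k, α * δ 1 = α) ∧
    (∀ (α : k) (a b : H), (α * δ a) * δ b = α * δ (a * b)) ∧
    -- the coaction `α ↦ σ ⊗ α` is counital and coassociative
    (∀ α : k,
      (TensorProduct.lid k k) ((LinearMap.rTensor k (Coalgebra.counit (R := k)))
        ((TensorProduct.mk k H k σ) α)) = α) ∧
    ((LinearMap.rTensor k (Coalgebra.comul (R := k))) ∘ₗ (TensorProduct.mk k H k σ)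
      = (TensorProduct.assoc k H H k).symm.toLinearMap
          ∘ₗ (LinearMap.lTensor H (TensorProduct.mk k H k σ))
          ∘ₗ (TensorProduct.mk k H k σ)) ∧
    -- the anti-Yetter–Drinfeld condition `ρ(α·h) = S(h₃) σ h₁ ⊗ δ(h₂) α`
    (∀ (α : k) (h : H) {ι : Type} (s : Finset ι) (c : ι → Fin 3 → H),
      IsComulRep k H 2 h s c →
      (TensorProduct.mk k H k σ) (α * δ h)
        = ∑ i ∈ s, (HopfAlgebra.antipode (R := k) (c i 2) * σ * c i 0) ⊗ₜ[k] (α * δ (c i 1))) ∧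
    -- which amounts to the identity `δ(h₂) S(h₃) σ h₁ = δ(h) σ` in `H`
    (∀ (h : H) {ι : Type} (s : Finset ι) (c : ι → Fin 3 → H),
      IsComulRep k H 2 h s c →
      ∑ i ∈ s, δ (c i 1) • (HopfAlgebra.antipode (R := k) (c i 2) * σ * c i 0) = δ h • σ) ∧
    -- stability
    (∀ α : k, α * δ σ = α) := by
  have key := fun (h : H) {ι : Type} (s : Finset ι) (c : ι → Fin 3 → H)
    (hc : IsComulRep k H 2 h s c) => ayd_key δ σ σinv hσinv₂ hMPI h s c hc
  refine ⟨fun α => by simp, fun α a b => by simp [mul_assoc], fun α => by simp [hσ.2], ?_, ?_,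
    key, fun α => by simp [hδσ]⟩
  · ext
    simp [hσ.1]
  · intro α h ι s c hc
    have h2 := congrArg (fun x => x ⊗ₜ[k] α) (key h s c hc)
    simp only [TensorProduct.sum_tmul, TensorProduct.smul_tmul, smul_eq_mul] at h2
    simp only [TensorProduct.mk_apply, mul_comm α]
    exact h2.symm


end HopfCyclicStmt
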